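/- Let n, M ∈ ℕ, let X be a set, let x ∈ X^n, and let H ⊆ {0,1}^X. If there exists a realizable adversary strategy A for x that forces every learner to make at least M mistakes on x, then there exists a realizable rigid adversary strategy A* for x, with witnessing function f : ⋃_{k=0}^{n-1} {0,1}^k → {0,1,★}, that forces every learner to make at least M mistakes on x, and such that for every y ∈ {0,1}^n the sequence f(y_{≤0}), f(y_{≤1}), …, f(y_{≤n-1}) has at least M members equal to ★ (where y_{≤i} denotes the prefix of y of length i). -/

import Mathlib

/-- An adversary strategy: given the history of (prediction, label) pairs and the
learner's current prediction, output a label. -/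
abbrev Adversary : Type := List (Bool × Bool) → Bool → Bool

/-- A learner strategy: given the past labels, output a prediction. -/
abbrev Learner : Type := List Bool → Bool

/-- The history of (prediction, label) pairs produced in the first `t` rounds of
playing learner `L` against adversary `A`. -/
def hist (A : Adversary) (L : Learner) : ℕ → List (Bool × Bool)
  | 0 => []
  | t + 1 =>
      let h := hist A L t
      let p := L (h.map Prod.snd)
      h ++ [(p, A h p)]

/-- The learner's prediction at round `t` (0-based). -/
def predAt (A : Adversary) (L : Learner) (t : ℕ) : Bool :=
  L ((hist A L t).map Prod.snd)

/-- The adversary's label at round `t` (0-based). -/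
def labelAt (A : Adversary) (L : Learner) (t : ℕ) : Bool :=
  A (hist A L t) (predAt A L t)

/-- The number of mistakes the learner `L` makes in `n` rounds against adversary `A`. -/
def mistakes (A : Adversary) (L : Learner) (n : ℕ) : ℕ :=
  ((Finset.range n).filter fun t => predAt A L t ≠ labelAt A L t).card

/-- The adversary `A` is realizable for the class `H` on the instance sequence `x`:
whatever the learner does, the produced labels are consistent with some `h ∈ H`. -/
def Realizable {X : Type*} (H : Set (X → Bool)) {n : ℕ} (x : Fin n → X) (A : Adversary) : Prop :=
  ∀ L : Learner, ∃ h ∈ H, ∀ i : Fin n, h (x i) = labelAt A L i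

/-- The adversary `A` forces every learner to make at least `M` mistakes in `n` rounds. -/
def Forces (A : Adversary) (n M : ℕ) : Prop :=
  ∀ L : Learner, M ≤ mistakes A L n

/-- The minimal sequence length for forcing `M` mistakes for the class `H`
(`⊤` if no sequence allows forcing `M` mistakes). -/
noncomputable def minSeq {X : Type*} (H : Set (X → Bool)) (M : ℕ) : ℕ∞ :=
  sInf {e : ℕ∞ | ∃ n : ℕ, e = (n : ℕ∞) ∧
    ∃ (x : Fin n → X) (A : Adversary), Realizable H x A ∧ Forces A n M}

/-- `f` witnesses the rigidity of the adversary `A` for sequences of length `n`: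
on any history of length `< n` whose labels are `y`, the adversary answers `f y`
when `f y ∈ {0,1}` (`some` value), and answers the negation of the learner's current
prediction when `f y = ★` (`none`). -/
def RigidWitness (n : ℕ) (A : Adversary) (f : List Bool → Option Bool) : Prop :=
  ∀ h : List (Bool × Bool), h.length < n → ∀ b : Bool,
    A h b = (f (h.map Prod.snd)).getD (!b)

/-- The adversary `A` is rigid (for sequences of length `n`). -/
def Rigid (n : ℕ) (A : Adversary) : Prop :=
  ∃ f : List Bool → Option Bool, RigidWitness n A f

/-- The (0-based) index `t` is essential for a rigid adversary with witness `f`,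
for forcing `M` mistakes: there is a label sequence `y` of length `t` with `f y = ★`
such that `f (y.take 0), f (y.take 1), …, f (y.take t)` has at most `M - 1`
entries equal to `★` (`none`). -/
def Essential (f : List Bool → Option Bool) (M t : ℕ) : Prop :=
  ∃ y : List Bool, y.length = t ∧ f y = none ∧
    ((Finset.range (t + 1)).filter fun i => f (y.take i) = none).card ≤ M - 1

/-- The number of stars of `f` along the first `m` prefixes of `z`. -/
def starCount (f : List Bool → Option Bool) (m : ℕ) (z : List Bool) : ℕ :=
  ((Finset.range m).filter fun t => f (z.take t) = none).card

/-- The label sequence `z` is compatible with the forced answers of `f`. -/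
def Follows (f : List Bool → Option Bool) (m : ℕ) (z : List Bool) : Prop :=
  ∀ i < m, ∀ b, f (z.take i) = some b → z[i]? = some b

/-- With `m` rounds to go after labels `y`, some rigid strategy stays in `R` and has `k` stars. -/
def Good (R : List Bool → Prop) (m : ℕ) (y : List Bool) (k : ℕ) : Prop :=
  ∃ f : List Bool → Option Bool,
    (∀ z : List Bool, z.length = m → Follows f m z → R (y ++ z)) ∧
    ∀ z : List Bool, z.length = m → k ≤ starCount f m z

theorem starCount_succ (f : List Bool → Option Bool) (m : ℕ) (b : Bool) (z : List Bool) :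
    starCount f (m + 1) (b :: z)
      = starCount (fun w => f (b :: w)) m z + (if f [] = none then 1 else 0) := by
  unfold starCount
  rw [Finset.card_filter, Finset.card_filter, Finset.sum_range_succ']
  simp only [List.take_succ_cons, List.take_zero]
  congr!

theorem Follows.tail {f : List Bool → Option Bool} {m : ℕ} {b : Bool} {z : List Bool}
    (h : Follows f (m + 1) (b :: z)) : Follows (fun w => f (b :: w)) m z := by
  intro i hi c hc
  have := h (i + 1) (by omega) c (by simpa using hc)
  simpa using this

theorem Good.le {R : List Bool → Prop} {m : ℕ} {y : List Bool} {k : ℕ} (h : Good R m y k) :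
    k ≤ m := by
  obtain ⟨f, -, h2⟩ := h
  refine (h2 (List.replicate m true) (by simp)).trans ?_
  unfold starCount
  exact (Finset.card_filter_le _ _).trans (by simp)

/-- Glue a root value and two subtrees. -/
def glue (r : Option Bool) (g : Bool → List Bool → Option Bool) : List Bool → Option Bool
  | [] => r
  | b :: w => g b w

theorem Good.fixed {R : List Bool → Prop} {m : ℕ} {y : List Bool} {k : ℕ} (b : Bool)
    (h : Good R m (y ++ [b]) k) : Good R (m + 1) y k := by
  have hk := h.le
  obtain ⟨f, h1, h2⟩ := h
  refine ⟨glue (some b) (fun c w => if c = b then f w else none), ?_, ?_⟩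
  · rintro (_ | ⟨c, z⟩) hz hf
    · simp at hz
    · have hc : c = b := by
        have := hf 0 (by omega) b (by simp [glue])
        simpa using this
      subst hc
      have := h1 z (by simpa using hz) (by simpa [glue] using hf.tail)
      simpa using this
  · rintro (_ | ⟨c, z⟩) hz
    · simp at hz
    · rw [starCount_succ]
      refine le_trans ?_ (Nat.le_add_right _ _)
      by_cases hc : c = b
      · simpa [glue, hc] using h2 z (by simpa using hz)
      · simpa [glue, hc, starCount] using hk

theorem Good.star {R : List Bool → Prop} {m : ℕ} {y : List Bool} {k : ℕ}
    (h : ∀ b, Good R m (y ++ [b]) (k - 1)) : Good R (m + 1) y k := by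
  choose f h1 h2 using h
  refine ⟨glue none f, ?_, ?_⟩
  · rintro (_ | ⟨c, z⟩) hz hf
    · simp at hz
    · have := h1 c z (by simpa using hz) (by simpa [glue] using hf.tail)
      simpa using this
  · rintro (_ | ⟨c, z⟩) hz
    · simp at hz
    · rw [starCount_succ]
      have := h2 c z (by simpa using hz)
      simp only [glue, if_true]
      change k ≤ starCount (f c) m z + 1
      omega

theorem hist_length (A : Adversary) (L : Learner) (t : ℕ) : (hist A L t).length = t := by
  induction t with
  | zero => rfl
  | succ t ih => simp [hist, ih]

theorem hist_succ (A : Adversary) (L : Learner) (t : ℕ) :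
    hist A L (t + 1) = hist A L t ++ [(predAt A L t, labelAt A L t)] := rfl

theorem mistakes_succ (A : Adversary) (L : Learner) (t : ℕ) :
    mistakes A L (t + 1)
      = mistakes A L t + (if predAt A L t ≠ labelAt A L t then 1 else 0) := by
  unfold mistakes
  rw [Finset.card_filter, Finset.card_filter, Finset.sum_range_succ]

theorem hist_take (A : Adversary) (L : Learner) (n t : ℕ) (h : t ≤ n) :
    (hist A L n).take t = hist A L t := by
  induction n with
  | zero => obtain rfl : t = 0 := by omega
            simp [hist]
  | succ n ih =>
    rcases Nat.lt_or_ge n t with h' | h'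
    · obtain rfl : t = n + 1 := by omega
      exact List.take_of_length_le (by simp [hist_length])
    · rw [hist_succ, List.take_append_of_le_length (by simpa [hist_length] using h'), ih h']

theorem hist_labels_get (A : Adversary) (L : Learner) (n t : ℕ) (h : t < n) :
    ((hist A L n).map Prod.snd)[t]? = some (labelAt A L t) := by
  have h1 : (hist A L n)[t]? = (hist A L (t + 1))[t]? := by
    rw [← hist_take A L n (t + 1) h, List.getElem?_take_of_lt (by omega)]
  rw [List.getElem?_map, h1, hist_succ]
  have := hist_length A L t
  rw [List.getElem?_append_right (by omega)]
  simp [this]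

/-- The learner which predicts obliviously. -/
def obl (p : ℕ → Bool) : Learner := fun ys => p ys.length

theorem predAt_obl (A : Adversary) (p : ℕ → Bool) (t : ℕ) : predAt A (obl p) t = p t := by
  simp [predAt, obl, hist_length]

theorem hist_obl_congr (A : Adversary) (p q : ℕ → Bool) (t : ℕ) (h : ∀ i < t, p i = q i) :
    hist A (obl p) t = hist A (obl q) t ∧ mistakes A (obl p) t = mistakes A (obl q) t := by
  induction t with
  | zero => simp [hist, mistakes]
  | succ t ih =>
    obtain ⟨h1, h2⟩ := ih fun i hi => h i (by omega)
    have h3 := h t (by omega)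
    simp only [hist_succ, mistakes_succ, labelAt, predAt_obl, h1, h2, h3, and_self]

theorem good_of_forces (R : List Bool → Prop) (A : Adversary) (n M : ℕ)
    (hR : ∀ L, R ((hist A L n).map Prod.snd)) (hforce : Forces A n M) (m : ℕ) :
    ∀ t, t + m = n → ∀ p : ℕ → Bool,
      Good R m ((hist A (obl p) t).map Prod.snd) (M - mistakes A (obl p) t) := by
  induction m with
  | zero =>
    rintro t ht p
    obtain rfl : t = n := by omega
    have := hforce (obl p)
    refine ⟨fun _ => none, ?_, ?_⟩
    · intro z hz _
      obtain rfl := List.length_eq_zero_iff.1 hz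
      simpa using hR (obl p)
    · intro z _
      omega
  | succ m ih =>
    intro t ht p
    have key : ∀ b, Good R m
        ((hist A (obl p) t).map Prod.snd ++ [A (hist A (obl p) t) b])
        (M - (mistakes A (obl p) t + (if b ≠ A (hist A (obl p) t) b then 1 else 0))) := by
      intro b
      have h := ih (t + 1) (by omega) (Function.update p t b)
      obtain ⟨h1, h2⟩ := hist_obl_congr A (Function.update p t b) p t
        fun i hi => Function.update_of_ne (by omega) _ _
      rw [hist_succ, mistakes_succ, labelAt, predAt_obl, h1, h2] at h
      simpa using h
    by_cases hb : ∃ b, A (hist A (obl p) t) b = b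
    · obtain ⟨b, hb⟩ := hb
      have := key b
      rw [hb] at this
      exact Good.fixed b (by simpa using this)
    · push Not at hb
      refine Good.star fun b => ?_
      have h1 : A (hist A (obl p) t) (!b) = b := by
        have := hb (!b)
        revert this
        cases A (hist A (obl p) t) (!b) <;> cases b <;> simp
      have := key (!b)
      rw [h1] at this
      simpa [Nat.sub_sub] using this

/-- If some realizable adversary forces `M` mistakes on `x`, then some realizable
rigid adversary, with rigidity witness `f`, forces `M` mistakes on `x`, and moreover
for every label sequence `y` of length `n`, at least `M` of the values
`f (y.take 0), …, f (y.take (n-1))` are `★` (`none`). -/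
theorem exists_rigid_adversary_many_stars {X : Type*} (n M : ℕ) (x : Fin n → X)
    (H : Set (X → Bool)) (A : Adversary)
    (hreal : Realizable H x A) (hforce : Forces A n M) :
    ∃ (A' : Adversary) (f : List Bool → Option Bool),
      Realizable H x A' ∧ RigidWitness n A' f ∧ Forces A' n M ∧
      ∀ y : List Bool, y.length = n →
        M ≤ ((Finset.range n).filter fun t => f (y.take t) = none).card := by
  obtain ⟨f, h1, h2⟩ := good_of_forces
    (fun ys => ∃ h ∈ H, ∀ i : Fin n, ys[(i : ℕ)]? = some (h (x i))) A n M
    (fun L => by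
      obtain ⟨h, hH, hh⟩ := hreal L
      exact ⟨h, hH, fun i => by rw [hist_labels_get A L n i i.2, hh i]⟩)
    hforce n 0 (by omega) (fun _ => true)
  have h3 : ∀ z : List Bool, z.length = n → M ≤ starCount f n z := by
    simpa [mistakes] using h2
  refine ⟨fun h b => (f (h.map Prod.snd)).getD (!b), f, ?_, fun h _ b => rfl, ?_, h3⟩
  · intro L
    set A' : Adversary := fun h b => (f (h.map Prod.snd)).getD (!b) with hA'
    obtain ⟨h, hH, hh⟩ := h1 ((hist A' L n).map Prod.snd) (by simp [hist_length]) (by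
      intro i hi b hb
      rw [← List.map_take, hist_take A' L n i hi.le] at hb
      rw [hist_labels_get A' L n i hi]
      change some ((f ((hist A' L i).map Prod.snd)).getD _) = _
      rw [hb]; rfl)
    refine ⟨h, hH, fun i => ?_⟩
    have := hh i
    simp only [hist, List.map_nil, List.nil_append] at this
    rw [hist_labels_get A' L n i i.2] at this
    exact (Option.some.inj this).symm
  · intro L
    set A' : Adversary := fun h b => (f (h.map Prod.snd)).getD (!b) with hA'
    refine (h3 ((hist A' L n).map Prod.snd) (by simp [hist_length])).trans ?_
    unfold starCount mistakes
    refine Finset.card_le_card fun t ht => ?_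
    rw [Finset.mem_filter] at ht ⊢
    obtain ⟨ht, hs⟩ := ht
    refine ⟨ht, ?_⟩
    rw [← List.map_take, hist_take A' L n t (Finset.mem_range.1 ht).le] at hs
    have : labelAt A' L t = !predAt A' L t := by
      change (f ((hist A' L t).map Prod.snd)).getD _ = _
      rw [hs]; rfl
    rw [this]
    simp
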